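/- arXiv:1403.7017 — 3 statements merged into one kernel-verified Lean document; each statement's English description precedes it below -/
import Mathlib

section
/- For all positive integers M and N, the set of objective values b/(W₁+W₂) over all feasible triples (b, W₁, W₂) has a greatest element, and this greatest element equals min( (M·N)/(M+N), (3·N)/8 ) as a rational number. -/
/-- Feasibility of a triple `(b, W₁, W₂)` of positive integers for the DoF
maximization problem of the retrospective interference alignment scheme on
the 3-user `(M,N)` MIMO interference channel with delayed CSIT.
The `min` in the intersection-subspace constraint is taken over `ℤ`. -/
def Feasible (M N b W1 W2 : ℕ) : Prop :=
  0 < b ∧ 0 < W1 ∧ 0 < W2 ∧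
  b ≤ M * W1 ∧ b + 1 ≤ N * W1 ∧
  (b : ℤ) < 2 * min ((N : ℤ) * W1 - b) (b : ℤ) ∧
  5 * b ≤ 3 * (N * W1) ∧ b ≤ N * W2

/-- Objective value `b / (W₁ + W₂)` as a rational number. -/
def objValue (b W1 W2 : ℕ) : ℚ := (b : ℚ) / ((W1 : ℚ) + (W2 : ℚ))

theorem stmt_0 (M N : ℕ) (hM : 0 < M) (hN : 0 < N) :
    IsGreatest {q : ℚ | ∃ b W1 W2 : ℕ, Feasible M N b W1 W2 ∧ q = objValue b W1 W2}
      (min ((M : ℚ) * N / ((M : ℚ) + N)) (3 * (N : ℚ) / 8)) := by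
  have hM' : (0 : ℚ) < M := by exact_mod_cast hM
  have hN' : (0 : ℚ) < N := by exact_mod_cast hN
  constructor
  · by_cases h : 5 * M ≤ 3 * N
    · have hq : (5 : ℚ) * M ≤ 3 * N := by exact_mod_cast h
      refine ⟨M * N, N, M, ⟨by positivity, hN, hM, le_rfl, ?_, ?_, ?_, ?_⟩, ?_⟩
      · have : M + 1 ≤ N := by omega
        nlinarith
      · have hz : (3 : ℤ) * M < 2 * N := by omega
        have hMz : (0 : ℤ) < M := by exact_mod_cast hM
        have hNz : (0 : ℤ) < N := by exact_mod_cast hN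
        push_cast
        rcases min_choice ((N : ℤ) * N - M * N) ((M : ℤ) * N) with h1 | h1 <;> rw [h1] <;> nlinarith [mul_pos hMz hNz]
      · nlinarith
      · exact (mul_comm M N).le
      · unfold objValue
        push_cast
        rw [min_eq_left, add_comm (N : ℚ)]
        rw [div_le_div_iff₀ (by positivity) (by positivity)]
        nlinarith
    · have hq : (3 : ℚ) * N ≤ 5 * M := by exact_mod_cast (by omega : 3 * N ≤ 5 * M)
      refine ⟨3 * N, 5, 3, ⟨by omega, by omega, by omega, by omega, by omega, ?_, by omega, by omega⟩, ?_⟩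
      · push_cast
        omega
      · unfold objValue
        push_cast
        rw [min_eq_right]
        · norm_num
        rw [div_le_div_iff₀ (by positivity) (by positivity)]
        nlinarith
  · rintro q ⟨b, W1, W2, ⟨hb, h1, h2, hbM, -, -, h5, hbN⟩, rfl⟩
    have h1' : (0 : ℚ) < W1 := by exact_mod_cast h1
    have h2' : (0 : ℚ) < W2 := by exact_mod_cast h2
    have a1 : (b : ℚ) ≤ M * W1 := by exact_mod_cast hbM
    have a2 : (b : ℚ) ≤ N * W2 := by exact_mod_cast hbN
    have a3 : (5 : ℚ) * b ≤ 3 * (N * W1) := by exact_mod_cast h5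
    unfold objValue
    apply le_min
    · rw [div_le_div_iff₀ (by positivity) (by positivity)]
      nlinarith
    · rw [div_le_div_iff₀ (by positivity) (by positivity)]
      nlinarith
end

section
/- Let M and N be positive integers with N < 2·M and 5·M ≤ 3·N (i.e. 1/2 < M/N ≤ 3/5). Then the greatest objective value b/(W₁+W₂) over all feasible triples (b, W₁, W₂) equals (M·N)/(M+N), and it is attained by the feasible triple (M·N, N, M). -/
theorem stmt_5 (M N : ℕ) (hM : 0 < M) (hN : 0 < N)
    (h1 : N < 2 * M) (h2 : 5 * M ≤ 3 * N) :
    IsGreatest {q : ℚ | ∃ b W1 W2 : ℕ, Feasible M N b W1 W2 ∧ q = objValue b W1 W2}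
      ((M : ℚ) * N / ((M : ℚ) + N)) ∧
    Feasible M N (M * N) N M ∧
      objValue (M * N) N M = (M : ℚ) * N / ((M : ℚ) + N) := by
  have hf : Feasible M N (M * N) N M := by
    have hpos : 0 < M * N := Nat.mul_pos hM hN
    refine ⟨hpos, hN, hM, le_refl _, ?_, ?_, ?_, (Nat.mul_comm M N).le⟩
    · have : M + 1 ≤ N := by omega
      nlinarith
    · have h3 : (3 * M + 1 : ℤ) ≤ 2 * N := by omega
      have hN' : (0 : ℤ) < N := by exact_mod_cast hN
      have hM' : (0 : ℤ) < M := by exact_mod_cast hM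
      push_cast
      rcases min_choice ((N : ℤ) * N - M * N) ((M : ℤ) * N) with h | h <;> rw [h] <;> nlinarith [mul_pos hM' hN']
    · nlinarith
  have ho : objValue (M * N) N M = (M : ℚ) * N / ((M : ℚ) + N) := by
    unfold objValue
    push_cast
    rw [add_comm (N : ℚ)]
  refine ⟨⟨⟨_, _, _, hf, ho.symm⟩, ?_⟩, hf, ho⟩
  rintro q ⟨b, W1, W2, ⟨hb, hW1, hW2, ha, -, -, -, hc⟩, rfl⟩
  unfold objValue
  have hM' : (0 : ℚ) < M := by exact_mod_cast hM
  have hN' : (0 : ℚ) < N := by exact_mod_cast hN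
  have h1' : (0 : ℚ) < W1 := by exact_mod_cast hW1
  have h2' : (0 : ℚ) < W2 := by exact_mod_cast hW2
  have ha' : (b : ℚ) ≤ M * W1 := by exact_mod_cast ha
  have hc' : (b : ℚ) ≤ N * W2 := by exact_mod_cast hc
  rw [div_le_div_iff₀ (by positivity) (by positivity)]
  nlinarith [mul_le_mul_of_nonneg_left ha' hN'.le, mul_le_mul_of_nonneg_left hc' hM'.le]
end

section
/- Let M and N be positive integers with 3·N ≤ 5·M (i.e. M/N ≥ 3/5). Then the greatest objective value b/(W₁+W₂) over all feasible triples (b, W₁, W₂) equals (3·N)/8, and it is attained by the feasible triple (3·N, 5, 3). -/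
theorem stmt_6 (M N : ℕ) (hM : 0 < M) (hN : 0 < N) (h : 3 * N ≤ 5 * M) :
    IsGreatest {q : ℚ | ∃ b W1 W2 : ℕ, Feasible M N b W1 W2 ∧ q = objValue b W1 W2}
      (3 * (N : ℚ) / 8) ∧
    Feasible M N (3 * N) 5 3 ∧ objValue (3 * N) 5 3 = 3 * (N : ℚ) / 8 := by
  have hf : Feasible M N (3 * N) 5 3 := by
    refine ⟨by omega, by omega, by omega, by omega, by omega, ?_, by omega, by omega⟩
    push_cast
    omega
  have ho : objValue (3 * N) 5 3 = 3 * (N : ℚ) / 8 := by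
    unfold objValue
    push_cast
    norm_num
  refine ⟨⟨⟨3 * N, 5, 3, hf, ho.symm⟩, ?_⟩, hf, ho⟩
  rintro q ⟨b, W1, W2, ⟨_, h1, h2, _, _, _, h3, h4⟩, rfl⟩
  unfold objValue
  have h1' : (0 : ℚ) < W1 := by exact_mod_cast h1
  have h2' : (0 : ℚ) < W2 := by exact_mod_cast h2
  have h3' : 5 * (b : ℚ) ≤ 3 * (N * W1) := by exact_mod_cast h3
  have h4' : (b : ℚ) ≤ N * W2 := by exact_mod_cast h4
  rw [div_le_div_iff₀ (by positivity) (by norm_num)]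
  linarith
end
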